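/- Let n ∈ ℕ, let k be a positive even integer, and let ε > 0. Let h : ℝⁿ → ℂ be C^k such that for every point of ℝⁿ there exist a neighborhood and an index in (0,1) on which all k-th order partial derivatives of h are Hölder continuous, and such that h and all of its partial derivatives of order ≤ k are O(|x|^{-2-ε}) as |x| → ∞. Then for every x ∈ ℝⁿ there exist η > 0 and a holomorphic function F on the strip {α ∈ ℂ : -k - η < Re α < 2 + ε} \ (n + 2ℕ₀) such that F(α) = (I^α h)(x) = (1/H_n(α)) ∫_{ℝⁿ} h(y)|x - y|^{α-n} dy whenever 0 < Re α < 2 + ε and α ∉ n + 2ℕ₀, and F(-k) = ((-Δ)^{k/2} h)(x), where Δ is the Laplacian on ℝⁿ. (In the notation of the paper: (-Δ)^{k/2} h = I^{-k} h.) -/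

import Mathlib

open Complex MeasureTheory Filter Asymptotics Set Metric

/-- `H_n(α) = 2^α π^(n/2) Γ(α/2) / Γ((n-α)/2)`. -/
noncomputable def Hfun (n : ℕ) (α : ℂ) : ℂ :=
  (2 : ℂ) ^ α * (Real.pi : ℂ) ^ ((n : ℂ) / 2) * Complex.Gamma (α / 2) /
    Complex.Gamma (((n : ℂ) - α) / 2)

/-- The Riesz potential `(I^α f)(x) = (1/H_n(α)) ∫_{ℝⁿ} f(y) |x-y|^{α-n} dy`. -/
noncomputable def riesz (n : ℕ) (f : EuclideanSpace ℝ (Fin n) → ℂ) (α : ℂ)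
    (x : EuclideanSpace ℝ (Fin n)) : ℂ :=
  (Hfun n α)⁻¹ * ∫ y : EuclideanSpace ℝ (Fin n), f y * (‖x - y‖ : ℂ) ^ (α - n)

/-- The Laplacian `Δφ = ∑ i ∂²φ/∂xᵢ²` on `ℝⁿ`. -/
noncomputable def lap (n : ℕ) (φ : EuclideanSpace ℝ (Fin n) → ℂ)
    (x : EuclideanSpace ℝ (Fin n)) : ℂ :=
  ∑ i : Fin n,
    fderiv ℝ (fun y => fderiv ℝ φ y (EuclideanSpace.single i 1)) x (EuclideanSpace.single i 1)

/-- The set `n + 2ℕ₀ ⊆ ℂ` of zeros of `H_n`. -/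
def poleSet (n : ℕ) : Set ℂ := {α : ℂ | ∃ m : ℕ, α = (n : ℂ) + 2 * m}

/-- `φ` is of class `C^k` with bounded derivatives of order at most `k`, and its `k`-th derivative
is Hölder continuous of exponent `θ` at the point `x`. -/
structure HolderRegularAt {V : Type*} [NormedAddCommGroup V] [NormedSpace ℝ V]
    (k : ℕ) (θ : ℝ) (φ : V → ℂ) (x : V) : Prop where
  contDiff : ContDiff ℝ k φ
  bounded : ∀ j ≤ k, ∃ C, ∀ y, ‖iteratedFDeriv ℝ j φ y‖ ≤ C
  holder : ∃ C, ∀ y, ‖iteratedFDeriv ℝ k φ y - iteratedFDeriv ℝ k φ x‖ ≤ C * ‖y - x‖ ^ θ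

namespace HolderRegularAt

variable {V : Type*} [NormedAddCommGroup V] [NormedSpace ℝ V] {k : ℕ} {θ : ℝ} {φ ψ : V → ℂ} {x : V}

/-- A derivative of a directional derivative of `φ` is a fixed linear image of the derivative of `φ`
of one order higher. -/
theorem exists_iteratedFDeriv_fderiv_apply (e : V) (j : ℕ) :
    ∃ L : (V [×(j + 1)]→L[ℝ] ℂ) →L[ℝ] (V [×j]→L[ℝ] ℂ), ∀ φ : V → ℂ, ContDiff ℝ (j + 1 : ℕ) φ →
      ∀ y, iteratedFDeriv ℝ j (fun z => fderiv ℝ φ z e) y = L (iteratedFDeriv ℝ (j + 1) φ y) := by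
  refine ⟨(ContinuousLinearMap.compContinuousMultilinearMapL ℝ (fun _ : Fin j => V) (V →L[ℝ] ℂ) ℂ
    (ContinuousLinearMap.apply ℝ ℂ e)).comp
      (continuousMultilinearCurryRightEquiv' ℝ j V ℂ).toContinuousLinearEquiv.toContinuousLinearMap,
    fun φ hφ y => ?_⟩
  have h1 : ContDiff ℝ j (fderiv ℝ φ) := hφ.fderiv_right (by norm_cast)
  have h2 := (ContinuousLinearMap.apply ℝ ℂ e).iteratedFDeriv_comp_left
    (h1.contDiffAt (x := y)) (i := j) le_rfl
  rw [iteratedFDeriv_succ_eq_comp_right]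
  simp only [Function.comp_apply, ContinuousLinearMap.comp_apply]
  erw [(continuousMultilinearCurryRightEquiv' ℝ j V ℂ).apply_symm_apply]
  exact h2

theorem fderiv_apply (h : HolderRegularAt (k + 1) θ φ x) (e : V) :
    HolderRegularAt k θ (fun y => fderiv ℝ φ y e) x where
  contDiff := (h.contDiff.fderiv_right (by norm_cast)).clm_apply contDiff_const
  bounded j hj := by
    obtain ⟨L, hL⟩ := exists_iteratedFDeriv_fderiv_apply e j
    obtain ⟨C, hC⟩ := h.bounded (j + 1) (by omega)
    refine ⟨‖L‖ * C, fun y => ?_⟩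
    rw [hL φ (h.contDiff.of_le (by norm_cast; omega))]
    exact (L.le_opNorm _).trans (by gcongr; exact hC y)
  holder := by
    obtain ⟨L, hL⟩ := exists_iteratedFDeriv_fderiv_apply e k
    obtain ⟨C, hC⟩ := h.holder
    refine ⟨‖L‖ * C, fun y => ?_⟩
    rw [hL φ h.contDiff, hL φ h.contDiff, ← map_sub, mul_assoc]
    exact (L.le_opNorm _).trans (by gcongr; exact hC y)

theorem zero : HolderRegularAt k θ (fun _ => (0 : ℂ)) x where
  contDiff := contDiff_const
  bounded j _ := ⟨0, fun y => by
    simp [show iteratedFDeriv ℝ j (fun _ : V => (0 : ℂ)) = 0 from iteratedFDeriv_fun_zero]⟩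
  holder := ⟨0, fun y => by
    simp [show iteratedFDeriv ℝ k (fun _ : V => (0 : ℂ)) = 0 from iteratedFDeriv_fun_zero]⟩

theorem add (hφ : HolderRegularAt k θ φ x) (hψ : HolderRegularAt k θ ψ x) :
    HolderRegularAt k θ (fun y => φ y + ψ y) x := by
  have key (j : ℕ) (hj : j ≤ k) (y : V) : iteratedFDeriv ℝ j (fun y => φ y + ψ y) y =
      iteratedFDeriv ℝ j φ y + iteratedFDeriv ℝ j ψ y :=
    iteratedFDeriv_add_apply (hφ.contDiff.of_le (by exact_mod_cast hj)).contDiffAt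
      (hψ.contDiff.of_le (by exact_mod_cast hj)).contDiffAt
  refine ⟨hφ.contDiff.add hψ.contDiff, fun j hj => ?_, ?_⟩
  · obtain ⟨C, hC⟩ := hφ.bounded j hj
    obtain ⟨D, hD⟩ := hψ.bounded j hj
    refine ⟨C + D, fun y => ?_⟩
    rw [key j hj]
    exact norm_add_le_of_le (hC y) (hD y)
  · obtain ⟨C, hC⟩ := hφ.holder
    obtain ⟨D, hD⟩ := hψ.holder
    refine ⟨C + D, fun y => ?_⟩
    rw [key k le_rfl, key k le_rfl, add_sub_add_comm, add_mul]
    exact norm_add_le_of_le (hC y) (hD y)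

theorem neg (hφ : HolderRegularAt k θ φ x) : HolderRegularAt k θ (fun y => -φ y) x := by
  have key (j : ℕ) (y : V) : iteratedFDeriv ℝ j (fun y => -φ y) y = -iteratedFDeriv ℝ j φ y :=
    iteratedFDeriv_neg_apply
  refine ⟨hφ.contDiff.neg, fun j hj => ?_, ?_⟩
  · simpa only [key, norm_neg] using hφ.bounded j hj
  · simpa only [key, neg_sub_neg, norm_sub_rev (iteratedFDeriv ℝ k φ x)] using hφ.holder

theorem sum {ι : Type*} (s : Finset ι) {φ : ι → V → ℂ} (h : ∀ i, HolderRegularAt k θ (φ i) x) :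
    HolderRegularAt k θ (fun y => ∑ i ∈ s, φ i y) x := by
  classical
  induction s using Finset.induction_on with
  | empty => simpa using zero
  | insert i s hi ih => simpa [Finset.sum_insert hi] using (h i).add ih

theorem neg_lap {n : ℕ} {φ : EuclideanSpace ℝ (Fin n) → ℂ} {x : EuclideanSpace ℝ (Fin n)}
    (h : HolderRegularAt (k + 2) θ φ x) : HolderRegularAt k θ (fun y => -lap n φ y) x :=
  (sum _ fun _ => (h.fderiv_apply _).fderiv_apply _).neg

theorem continuous (h : HolderRegularAt k θ φ x) : Continuous φ := h.contDiff.continuous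

theorem exists_norm_le (h : HolderRegularAt k θ φ x) : ∃ C, ∀ y, ‖φ y‖ ≤ C := by
  simpa using h.bounded 0 (Nat.zero_le _)

theorem exists_norm_fderiv_le (h : HolderRegularAt (k + 1) θ φ x) :
    ∃ C, ∀ y, ‖fderiv ℝ φ y‖ ≤ C := by
  simpa [← norm_iteratedFDeriv_fderiv] using h.bounded 1 (by omega)

end HolderRegularAt

theorem hasFDerivAt_exp_neg_sq_norm {V : Type*} [NormedAddCommGroup V] [InnerProductSpace ℝ V]
    (w : V) :
    HasFDerivAt (fun w : V => ((Real.exp (-‖w‖ ^ 2) : ℝ) : ℂ))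
      (Complex.ofRealCLM.comp (Real.exp (-‖w‖ ^ 2) • -((2 : ℝ) • innerSL ℝ w))) w := by
  have h1 : HasFDerivAt (fun w : V => ‖w‖ ^ 2) ((2 : ℝ) • innerSL ℝ w) w := by
    simpa only [ofNat_smul_eq_nsmul] using (hasStrictFDerivAt_norm_sq w).hasFDerivAt
  exact Complex.ofRealCLM.hasFDerivAt.comp w h1.neg.exp

section GaussMean

variable {V : Type*} [NormedAddCommGroup V] [InnerProductSpace ℝ V] [FiniteDimensional ℝ V]
  [MeasurableSpace V] [BorelSpace V]

/-- The mean of `y ↦ φ (x + r y)` against the (unnormalised) Gaussian `exp (-‖y‖²)`. -/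
noncomputable def gaussMean (φ : V → ℂ) (x : V) (r : ℝ) : ℂ :=
  ∫ w : V, ((Real.exp (-‖w‖ ^ 2) : ℝ) : ℂ) * φ (x + r • w)

theorem integrable_rpow_norm_mul_exp_neg_sq [Nontrivial V] {p : ℝ} (hp : 0 ≤ p) :
    Integrable fun w : V => ‖w‖ ^ p * Real.exp (-‖w‖ ^ 2) := by
  rw [integrable_fun_norm_addHaar volume (f := fun r : ℝ => r ^ p * Real.exp (-r ^ 2))]
  refine (integrableOn_rpow_mul_exp_neg_mul_sq one_pos
    (s := ((Module.finrank ℝ V - 1 : ℕ) : ℝ) + p)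
    (neg_one_lt_zero.trans_le (by positivity))).congr_fun (fun r hr => ?_)
    measurableSet_Ioi
  rw [mem_Ioi] at hr
  simp only [Real.rpow_add hr, Real.rpow_natCast, smul_eq_mul]
  ring_nf

theorem integrable_exp_neg_sq_norm [Nontrivial V] :
    Integrable fun w : V => Real.exp (-‖w‖ ^ 2) := by
  simpa using integrable_rpow_norm_mul_exp_neg_sq (V := V) le_rfl

theorem integrable_norm_mul_exp_neg_sq [Nontrivial V] :
    Integrable fun w : V => ‖w‖ * Real.exp (-‖w‖ ^ 2) := by
  simpa using integrable_rpow_norm_mul_exp_neg_sq (V := V) zero_le_one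

theorem integrable_gauss_mul [Nontrivial V] {φ : V → ℂ} (hφ : Continuous φ) {C : ℝ}
    (hC : ∀ w, ‖φ w‖ ≤ C * (1 + ‖w‖)) :
    Integrable fun w : V => ((Real.exp (-‖w‖ ^ 2) : ℝ) : ℂ) * φ w := by
  refine Integrable.mono' ((integrable_exp_neg_sq_norm.add
    integrable_norm_mul_exp_neg_sq).const_mul C) (by fun_prop) (.of_forall fun w => ?_)
  rw [norm_mul, Complex.norm_real, Real.norm_of_nonneg (Real.exp_pos _).le]
  calc _ ≤ Real.exp (-‖w‖ ^ 2) * (C * (1 + ‖w‖)) := by gcongr; exact hC w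
    _ = _ := by simp only [Pi.add_apply]; ring

theorem integrable_gauss_mul_of_bounded [Nontrivial V] {φ : V → ℂ} (hφ : Continuous φ)
    (hC : ∃ C, ∀ w, ‖φ w‖ ≤ C) :
    Integrable fun w : V => ((Real.exp (-‖w‖ ^ 2) : ℝ) : ℂ) * φ w := by
  obtain ⟨C, hC⟩ := hC
  have hC0 : 0 ≤ C := (norm_nonneg _).trans (hC 0)
  exact integrable_gauss_mul hφ (C := C) fun w => (hC w).trans
    (le_mul_of_one_le_right hC0 (by linarith [norm_nonneg w]))

theorem gaussMean_zero (φ : V → ℂ) (x : V) :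
    gaussMean φ x 0 = (Real.pi : ℂ) ^ ((Module.finrank ℝ V : ℂ) / 2) * φ x := by
  have h := GaussianFourier.integral_rexp_neg_mul_sq_norm (V := V) one_pos
  simp only [gaussMean, zero_smul, add_zero]
  rw [integral_mul_const, integral_complex_ofReal]
  simp only [neg_mul, one_mul, div_one] at h
  rw [h, Complex.ofReal_cpow Real.pi_pos.le]
  simp

theorem continuous_gaussMean [Nontrivial V] {φ : V → ℂ} (hφ : Continuous φ)
    (hC : ∃ C, ∀ y, ‖φ y‖ ≤ C) (x : V) : Continuous (gaussMean φ x) := by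
  obtain ⟨C, hC⟩ := hC
  refine continuous_of_dominated (bound := fun w => Real.exp (-‖w‖ ^ 2) * C) (fun r => by fun_prop)
    (fun r => .of_forall fun w => ?_) (integrable_exp_neg_sq_norm.mul_const C)
    (.of_forall fun w => by fun_prop)
  rw [norm_mul, Complex.norm_real, Real.norm_of_nonneg (Real.exp_pos _).le]
  gcongr
  exact hC _

theorem hasDerivAt_gaussMean [Nontrivial V] {φ : V → ℂ} (hφ : ContDiff ℝ 1 φ)
    (hC : ∃ C, ∀ y, ‖φ y‖ ≤ C) (hD : ∃ D, ∀ y, ‖fderiv ℝ φ y‖ ≤ D) (x : V) (r : ℝ) :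
    HasDerivAt (gaussMean φ x)
      (∫ w : V, ((Real.exp (-‖w‖ ^ 2) : ℝ) : ℂ) * fderiv ℝ φ (x + r • w) w) r := by
  obtain ⟨D, hD⟩ := hD
  have hφc := hφ.continuous
  have hφ'c : Continuous (fderiv ℝ φ) := hφ.continuous_fderiv one_ne_zero
  refine (hasDerivAt_integral_of_dominated_loc_of_deriv_le
    (bound := fun w : V => D * (‖w‖ * Real.exp (-‖w‖ ^ 2))) (s := univ) (F' := fun r w =>
      ((Real.exp (-‖w‖ ^ 2) : ℝ) : ℂ) * fderiv ℝ φ (x + r • w) w) univ_mem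
    (.of_forall fun r => by fun_prop) ?_ ?_ (.of_forall fun w r _ => ?_)
    (integrable_norm_mul_exp_neg_sq.const_mul D) (.of_forall fun w r _ => ?_)).2
  · exact integrable_gauss_mul_of_bounded (by fun_prop) (hC.imp fun C hC w => hC _)
  · exact Continuous.aestronglyMeasurable (by fun_prop)
  · rw [norm_mul, Complex.norm_real, Real.norm_of_nonneg (Real.exp_pos _).le]
    have := (fderiv ℝ φ (x + r • w)).le_of_opNorm_le (hD _) w
    nlinarith [Real.exp_pos (-‖w‖ ^ 2)]
  · have h1 : HasDerivAt (fun r : ℝ => x + r • w) w r := by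
      simpa using ((hasDerivAt_id r).smul_const w).const_add x
    exact (((hφ.differentiable one_ne_zero).differentiableAt.hasFDerivAt).comp_hasDerivAt r
      h1).const_mul _

/-- Integration by parts against the Gaussian. -/
theorem integral_gauss_mul_inner [Nontrivial V] {ψ : V → ℂ} (hψ : ContDiff ℝ 1 ψ)
    (hC : ∃ C, ∀ y, ‖ψ y‖ ≤ C) (hD : ∃ D, ∀ y, ‖fderiv ℝ ψ y‖ ≤ D) (x e : V) (r : ℝ) :
    ∫ w : V, ((Real.exp (-‖w‖ ^ 2) : ℝ) : ℂ) * ((inner ℝ w e : ℝ) * ψ (x + r • w)) =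
      r / 2 * gaussMean (fun y => fderiv ℝ ψ y e) x r := by
  obtain ⟨C, hC⟩ := hC
  obtain ⟨D, hD⟩ := hD
  have hC0 : 0 ≤ C := (norm_nonneg _).trans (hC 0)
  have hψc := hψ.continuous
  have hψ'c : Continuous (fderiv ℝ ψ) := hψ.continuous_fderiv one_ne_zero
  have hG (w : V) : fderiv ℝ (fun w : V => ((Real.exp (-‖w‖ ^ 2) : ℝ) : ℂ)) w e =
      -2 * (((Real.exp (-‖w‖ ^ 2) : ℝ) : ℂ) * (inner ℝ w e : ℝ)) := by
    rw [(hasFDerivAt_exp_neg_sq_norm w).fderiv]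
    simp
    ring
  have hψr (w : V) : HasFDerivAt (fun w => ψ (x + r • w)) (r • fderiv ℝ ψ (x + r • w)) w := by
    have h1 : HasFDerivAt (fun w : V => x + r • w) (r • ContinuousLinearMap.id ℝ V) w :=
      ((hasFDerivAt_id w).const_smul r).const_add x
    convert! ((hψ.differentiable one_ne_zero).differentiableAt.hasFDerivAt).comp w h1 using 1
    ext v
    simp
  have hi : Integrable fun w : V =>
      ((Real.exp (-‖w‖ ^ 2) : ℝ) : ℂ) * ((inner ℝ w e : ℝ) * ψ (x + r • w)) := by
    refine integrable_gauss_mul (by fun_prop) (C := ‖e‖ * C) fun w => ?_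
    rw [norm_mul, Complex.norm_real]
    have h2 : ‖inner ℝ w e‖ * ‖ψ (x + r • w)‖ ≤ (‖w‖ * ‖e‖) * C := by
      gcongr
      · exact norm_inner_le_norm w e
      · exact hC _
    have := mul_nonneg (norm_nonneg e) hC0
    nlinarith
  have key := integral_mul_fderiv_eq_neg_fderiv_mul_of_integrable (μ := (volume : Measure V))
    (f := fun w : V => ((Real.exp (-‖w‖ ^ 2) : ℝ) : ℂ)) (g := fun w => ψ (x + r • w)) (v := e)
    ?_ ?_ ?_ (fun w _ => (hasFDerivAt_exp_neg_sq_norm w).differentiableAt)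
    (fun w _ => (hψr w).differentiableAt)
  · simp only [hG, fun w => (hψr w).fderiv] at key
    have h1 : ∫ w : V, -2 * (((Real.exp (-‖w‖ ^ 2) : ℝ) : ℂ) * (inner ℝ w e : ℝ)) * ψ (x + r • w) =
        -2 * ∫ w : V, ((Real.exp (-‖w‖ ^ 2) : ℝ) : ℂ) * ((inner ℝ w e : ℝ) * ψ (x + r • w)) := by
      rw [← integral_const_mul]
      congr 1 with w
      ring
    have h2 : ∫ w : V, ((Real.exp (-‖w‖ ^ 2) : ℝ) : ℂ) * ((r • fderiv ℝ ψ (x + r • w)) e) =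
        r * gaussMean (fun y => fderiv ℝ ψ y e) x r := by
      rw [gaussMean, ← integral_const_mul]
      congr 1 with w
      simp
      ring
    rw [h1, h2] at key
    linear_combination -(1 / 2 : ℂ) * key
  · simp only [hG]
    refine (hi.const_mul (-2)).congr (.of_forall fun w => ?_)
    ring
  · simp only [fun w => (hψr w).fderiv]
    refine integrable_gauss_mul_of_bounded (by fun_prop) ⟨|r| * (D * ‖e‖), fun w => ?_⟩
    rw [smul_apply, norm_smul, Real.norm_eq_abs]
    gcongr
    exact (fderiv ℝ ψ (x + r • w)).le_of_opNorm_le (hD _) e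
  · exact integrable_gauss_mul_of_bounded (by fun_prop) ⟨C, fun w => hC _⟩

end GaussMean

section Heat

variable {n : ℕ} [NeZero n] {k : ℕ} {θ : ℝ} {φ : EuclideanSpace ℝ (Fin n) → ℂ}
  {x : EuclideanSpace ℝ (Fin n)}

/-- The heat equation, in the variable `r = 2 √t`. -/
theorem HolderRegularAt.hasDerivAt_gaussMean (h : HolderRegularAt (k + 2) θ φ x) (r : ℝ) :
    HasDerivAt (gaussMean φ x) (-(r / 2) * gaussMean (fun y => -lap n φ y) x r) r := by
  have hφ : ContDiff ℝ 1 φ := h.contDiff.of_le (by norm_cast; omega)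
  convert! _root_.hasDerivAt_gaussMean hφ h.exists_norm_le h.exists_norm_fderiv_le x r using 1
  have hi (i : Fin n) := h.fderiv_apply (EuclideanSpace.single i 1)
  have hii (i : Fin n) := (hi i).fderiv_apply (EuclideanSpace.single i 1)
  have hC1 (i : Fin n) : ContDiff ℝ 1 (fun y => fderiv ℝ φ y (EuclideanSpace.single i 1)) :=
    (hi i).contDiff.of_le (by norm_cast; omega)
  have hexp (w : EuclideanSpace ℝ (Fin n)) :
      ((Real.exp (-‖w‖ ^ 2) : ℝ) : ℂ) * fderiv ℝ φ (x + r • w) w =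
      ∑ i, ((Real.exp (-‖w‖ ^ 2) : ℝ) : ℂ) * ((inner ℝ w (EuclideanSpace.single i (1 : ℝ)) : ℝ) *
        fderiv ℝ φ (x + r • w) (EuclideanSpace.single i 1)) := by
    rw [← Finset.mul_sum]
    congr 1
    generalize fderiv ℝ φ (x + r • w) = L
    conv_lhs => rw [← (EuclideanSpace.basisFun (Fin n) ℝ).sum_repr w, map_sum]
    simp [EuclideanSpace.inner_single_right]
  simp only [hexp]
  rw [integral_finsetSum]
  · simp only [fun i => integral_gauss_mul_inner (hC1 i) (hi i).exists_norm_le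
      (hi i).exists_norm_fderiv_le x (EuclideanSpace.single i 1) r]
    rw [← Finset.mul_sum, neg_mul, ← mul_neg]
    congr 1
    simp only [gaussMean, lap, mul_neg, integral_neg, neg_neg, Finset.mul_sum]
    rw [integral_finsetSum]
    intro i _
    exact integrable_gauss_mul_of_bounded ((hii i).continuous.comp (by fun_prop))
      ((hii i).exists_norm_le.imp fun C hC w => hC _)
  · intro i _
    obtain ⟨C, hC⟩ := (hi i).exists_norm_le
    have hc := (hi i).continuous
    have hC0 : 0 ≤ C := (norm_nonneg _).trans (hC 0)
    refine integrable_gauss_mul (C := C) (by fun_prop) fun w => ?_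
    rw [norm_mul, Complex.norm_real]
    have h1 : ‖inner ℝ w (EuclideanSpace.single i (1 : ℝ))‖ ≤ ‖w‖ := by
      simpa using norm_inner_le_norm (𝕜 := ℝ) w (EuclideanSpace.single i (1 : ℝ))
    calc _ ≤ ‖w‖ * C := by gcongr; exact hC _
      _ ≤ C * (1 + ‖w‖) := by linarith

theorem HolderRegularAt.exists_norm_gaussMean_sub_le (hθ : 0 < θ)
    (h : HolderRegularAt 0 θ φ x) :
    ∃ C, ∀ r, 0 ≤ r → ‖gaussMean φ x r - gaussMean φ x 0‖ ≤ C * r ^ θ := by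
  obtain ⟨C, hC⟩ := h.holder
  have hC' (y : EuclideanSpace ℝ (Fin n)) : ‖φ y - φ x‖ ≤ C * ‖y - x‖ ^ θ := by
    refine le_trans (le_of_eq ?_) (hC y)
    simp only [iteratedFDeriv_zero_eq_comp, Function.comp_apply, ← map_sub,
      LinearIsometryEquiv.norm_map]
  have hc := h.continuous
  have hi (r : ℝ) := integrable_gauss_mul_of_bounded (φ := fun w => φ (x + r • w)) (by fun_prop)
    (h.exists_norm_le.imp fun C hC w => hC _)
  refine ⟨C * ∫ w : EuclideanSpace ℝ (Fin n), ‖w‖ ^ θ * Real.exp (-‖w‖ ^ 2), fun r hr => ?_⟩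
  rw [gaussMean, gaussMean, ← integral_sub (hi r) (hi 0), mul_right_comm,
    ← integral_const_mul]
  refine norm_integral_le_of_norm_le
    ((integrable_rpow_norm_mul_exp_neg_sq hθ.le).const_mul _) (.of_forall fun w => ?_)
  rw [← mul_sub, norm_mul, Complex.norm_real, Real.norm_of_nonneg (Real.exp_pos _).le]
  have h1 := hC' (x + r • w)
  rw [add_sub_cancel_left, norm_smul, Real.norm_of_nonneg hr,
    Real.mul_rpow hr (norm_nonneg w)] at h1
  simp only [zero_smul, add_zero]
  calc _ ≤ Real.exp (-‖w‖ ^ 2) * (C * (r ^ θ * ‖w‖ ^ θ)) := by gcongr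
    _ = _ := by ring

/-- The small-time expansion of the heat semigroup. -/
theorem HolderRegularAt.exists_norm_gaussMean_sub_sum_le (hθ : 0 < θ) (m : ℕ)
    (h : HolderRegularAt (2 * m) θ φ x) :
    ∃ C, ∀ r, 0 ≤ r → ‖gaussMean φ x r - ∑ j ∈ Finset.range (m + 1),
      ((-1) ^ j / (4 ^ j * j.factorial) *
        gaussMean ((fun (g : EuclideanSpace ℝ (Fin n) → ℂ) => fun y => -(lap n g y))^[j] φ) x 0) *
          (r : ℂ) ^ (2 * j)‖ ≤ C * r ^ (2 * m + θ : ℝ) := by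
  induction m generalizing φ with
  | zero => simpa using h.exists_norm_gaussMean_sub_le hθ
  | succ m ih =>
    have h' : HolderRegularAt (2 * m + 2) θ φ x := h
    obtain ⟨C, hC⟩ := ih h'.neg_lap
    set a : ℕ → ℂ := fun j => gaussMean
      ((fun (g : EuclideanSpace ℝ (Fin n) → ℂ) => fun y => -(lap n g y))^[j] φ) x 0 with ha
    refine ⟨C / 2, fun r hr => ?_⟩
    have hder (s : ℝ) : HasDerivAt (fun r : ℝ => gaussMean φ x r - ∑ j ∈ Finset.range (m + 1 + 1),
        ((-1) ^ j / (4 ^ j * j.factorial) * a j) * (r : ℂ) ^ (2 * j))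
        (-(s / 2) * (gaussMean (fun y => -lap n φ y) x s - ∑ j ∈ Finset.range (m + 1),
          ((-1) ^ j / (4 ^ j * j.factorial) * a (j + 1)) * (s : ℂ) ^ (2 * j))) s := by
      rw [mul_sub]
      refine (h'.hasDerivAt_gaussMean s).sub ?_
      simp only [Finset.sum_range_succ' _ (m + 1)]
      rw [Finset.mul_sum, ← add_zero (Finset.sum _ _)]
      refine (HasDerivAt.fun_sum fun j _ => ?_).add ?_
      · have h1 := ((hasDerivAt_id s).ofReal_comp.pow (2 * (j + 1))).const_mul
          ((-1) ^ (j + 1) / (4 ^ (j + 1) * ((j + 1).factorial : ℂ)) * a (j + 1))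
        convert! h1 using 1
        have h2 : (j.factorial : ℂ) ≠ 0 := by exact_mod_cast j.factorial_ne_zero
        have h3 : (j + 1 : ℂ) ≠ 0 := by exact_mod_cast j.succ_ne_zero
        rw [show 2 * (j + 1) - 1 = 2 * j + 1 by omega, Nat.factorial_succ]
        push_cast
        simp only [id]
        field_simp
        ring
      · simpa using hasDerivAt_const s _
    have hmvt := (convex_Icc 0 r).norm_image_sub_le_of_norm_hasDerivWithin_le
      (C := C / 2 * r ^ (2 * m + θ + 1 : ℝ))
      (fun s _ => (hder s).hasDerivWithinAt) (fun s hs => ?_) (left_mem_Icc.2 hr)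
      (right_mem_Icc.2 hr)
    · have h0 : gaussMean φ x (0 : ℝ) - ∑ j ∈ Finset.range (m + 1 + 1),
          ((-1) ^ j / (4 ^ j * j.factorial) * a j) * ((0 : ℝ) : ℂ) ^ (2 * j) = 0 := by
        rw [Finset.sum_eq_single_of_mem 0 (by simp) (fun j _ hj => by simp [hj])]
        simp [ha]
      rw [h0, sub_zero, sub_zero, Real.norm_of_nonneg hr, mul_assoc] at hmvt
      refine hmvt.trans_eq ?_
      congr 1
      nth_rewrite 2 [← Real.rpow_one r]
      rw [← Real.rpow_add_of_nonneg hr (by positivity) zero_le_one]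
      congr 1
      push_cast
      ring
    · have hs0 : 0 ≤ s := hs.1
      have h1 := hC s hs0
      have hC0 : 0 ≤ C := by simpa using (norm_nonneg _).trans (hC 1 zero_le_one)
      rw [norm_mul]
      have h2 : ‖-((s : ℂ) / 2)‖ = s / 2 := by
        rw [norm_neg, norm_div, Complex.norm_real, Real.norm_of_nonneg hs0]
        simp
      rw [h2]
      calc _ ≤ s / 2 * (C * s ^ (2 * m + θ : ℝ)) := by gcongr; exact h1
        _ ≤ r / 2 * (C * r ^ (2 * m + θ : ℝ)) := by gcongr <;> exact hs.2
        _ = _ := by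
          rw [Real.rpow_add_of_nonneg hr (by positivity) zero_le_one, Real.rpow_one]
          ring

end Heat

section MellinContinuation

/-- The entire function extending `s ↦ 1 / ((s + j) Γ(s))`. -/
noncomputable def gammaInvDiv (j : ℕ) (s : ℂ) : ℂ :=
  (∏ i ∈ Finset.range j, (s + i)) * (Complex.Gamma (s + (j + 1 : ℕ)))⁻¹

theorem differentiable_gammaInvDiv (j : ℕ) : Differentiable ℂ (gammaInvDiv j) := by
  refine Differentiable.mul ?_ (Complex.differentiable_one_div_Gamma.comp
    (differentiable_id.add_const _))
  exact Differentiable.fun_finsetProd fun i _ => differentiable_id.add_const _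

theorem Gamma_add_natCast {s : ℂ} (hs : 0 < s.re) (j : ℕ) :
    Complex.Gamma (s + j) = (∏ i ∈ Finset.range j, (s + i)) * Complex.Gamma s := by
  induction j with
  | zero => simp
  | succ j ih =>
    have h0 : s + j ≠ 0 := fun h => by
      have := congrArg Complex.re h
      simp at this
      linarith [(Nat.cast_nonneg j : (0 : ℝ) ≤ j)]
    rw [Nat.cast_succ, ← add_assoc, Complex.Gamma_add_one _ h0, ih, Finset.prod_range_succ]
    ring

theorem gammaInvDiv_of_re_pos {s : ℂ} (hs : 0 < s.re) (j : ℕ) :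
    gammaInvDiv j s = (Complex.Gamma s)⁻¹ * (s + j)⁻¹ := by
  have h0 (i : ℕ) : s + i ≠ 0 := fun h => by
    have := congrArg Complex.re h
    simp at this
    linarith [(Nat.cast_nonneg i : (0 : ℝ) ≤ i)]
  rw [gammaInvDiv, Gamma_add_natCast hs, Finset.prod_range_succ]
  have h1 : ∏ i ∈ Finset.range j, (s + i) ≠ 0 := Finset.prod_ne_zero_iff.2 fun i _ => h0 i
  field_simp [h0 j, Complex.Gamma_ne_zero_of_re_pos hs]

theorem gammaInvDiv_neg_of_lt {j m : ℕ} (h : j < m) : gammaInvDiv j (-m) = 0 := by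
  obtain ⟨d, rfl⟩ := Nat.exists_eq_add_of_lt h
  rw [gammaInvDiv, show (-((j + d + 1 : ℕ) : ℂ)) + (j + 1 : ℕ) = -(d : ℂ) by push_cast; ring,
    Complex.Gamma_neg_nat_eq_zero]
  simp

theorem gammaInvDiv_neg_self (m : ℕ) : gammaInvDiv m (-m) = (-1) ^ m * m.factorial := by
  rw [gammaInvDiv, show (-(m : ℂ)) + (m + 1 : ℕ) = 1 by push_cast; ring, Complex.Gamma_one,
    inv_one, mul_one, ← Finset.prod_range_reflect, ← Finset.prod_range_add_one_eq_factorial]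
  push_cast
  rw [← Finset.card_range m, ← Finset.prod_const, Finset.card_range, ← Finset.prod_mul_distrib]
  refine Finset.prod_congr rfl fun i hi => ?_
  rw [Finset.mem_range] at hi
  rw [show m - 1 - i = m - (1 + i) by omega, Nat.cast_sub (by omega)]
  push_cast
  ring

/-- Continuation of a Mellin transform divided by `Γ`, past the poles cancelled by `1 / Γ`. -/
theorem exists_continuation_mellin_div_Gamma {U : ℝ → ℂ} (hU : Continuous U)
    (htop : U =O[atTop] fun r => r ^ (-1 : ℝ)) (m : ℕ) {θ : ℝ} (hθ : 0 < θ) (c : ℕ → ℂ) {C : ℝ}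
    (hC : ∀ r, 0 ≤ r → ‖U r - ∑ j ∈ Finset.range (m + 1), c j * (r : ℂ) ^ (2 * j)‖ ≤
      C * r ^ (2 * m + θ : ℝ)) :
    ∃ G : ℂ → ℂ, DifferentiableOn ℂ G {α | -(2 * m : ℝ) - θ < α.re ∧ α.re < 1} ∧
      (∀ α : ℂ, 0 < α.re → α.re < 1 → G α = (Complex.Gamma (α / 2))⁻¹ * mellin U α) ∧
      G (-(2 * m)) = (-1) ^ m * m.factorial * c m / 2 := by
  set p : ℕ → ℝ → ℂ := fun j => indicator (Ioc 0 1) fun t : ℝ => (t : ℂ) ^ ((2 * j : ℕ) : ℂ) with hp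
  have hp1 (j : ℕ) {r : ℝ} (hr : r ∈ Ioc (0 : ℝ) 1) : p j r = (r : ℂ) ^ (2 * j) := by
    rw [hp]
    simp only [indicator_of_mem hr, Complex.cpow_natCast]
  set f : ℝ → ℂ := fun r => U r - ∑ j ∈ Finset.range (m + 1), c j • p j r with hf
  have hf_top : f =O[atTop] fun r => r ^ (-1 : ℝ) := by
    refine htop.congr' ?_ .rfl
    filter_upwards [eventually_gt_atTop 1] with r hr
    rw [hf]
    simp [hp, hr.not_ge]
  have hf_bot : f =O[nhdsWithin 0 (Ioi 0)] fun r => r ^ (-(-(2 * m : ℝ) - θ)) := by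
    refine IsBigO.of_bound C ?_
    filter_upwards [Ioc_mem_nhdsGT (zero_lt_one (α := ℝ))] with r hr
    rw [hf]
    simp only [hp1 _ hr, smul_eq_mul]
    rw [Real.norm_of_nonneg (Real.rpow_nonneg hr.1.le _)]
    convert hC r hr.1.le using 3
    ring
  have hpint (j : ℕ) : LocallyIntegrable (p j) := by
    have h1 : Continuous fun t : ℝ => (t : ℂ) ^ (2 * j) := by fun_prop
    refine (h1.locallyIntegrable.indicator (measurableSet_Ioc (a := 0) (b := 1))).congr
      (.of_forall fun t => ?_)
    simp only [hp, Complex.cpow_natCast]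
  have hfint : LocallyIntegrableOn f (Ioi 0) := by
    refine (hU.locallyIntegrable.sub ?_).locallyIntegrableOn _
    exact locallyIntegrable_finsetSum _ fun j _ => (hpint j).smul (c j)
  have hpm (j : ℕ) {α : ℂ} (hα : 0 < α.re) : HasMellin (p j) α (1 / (α + (2 * j : ℕ))) :=
    hasMellin_cpow_Ioc _ (by
      rw [Complex.natCast_re]
      exact add_pos_of_pos_of_nonneg hα (Nat.cast_nonneg _))
  refine ⟨fun α => (Complex.Gamma (α / 2))⁻¹ * mellin f α +
    ∑ j ∈ Finset.range (m + 1), c j / 2 * gammaInvDiv j (α / 2), ?_, ?_, ?_⟩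
  · intro α hα
    refine DifferentiableAt.differentiableWithinAt (DifferentiableAt.add (DifferentiableAt.mul ?_
      (mellin_differentiableAt_of_isBigO_rpow hfint hf_top hα.2 hf_bot hα.1))
      (DifferentiableAt.fun_sum fun j _ => ?_))
    · exact (Complex.differentiable_one_div_Gamma.comp (differentiable_id.div_const 2)) α
    · exact (((differentiable_gammaInvDiv j).comp (differentiable_id.div_const 2)).const_mul _) α
  · intro α hα hα1
    have hfm : MellinConvergent f α := mellinConvergent_of_isBigO_rpow hfint hf_top hα1 hf_bot
      (by have : (0 : ℝ) ≤ 2 * m := by positivity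
          linarith)
    have hsum : HasMellin (fun r => ∑ j ∈ Finset.range (m + 1), c j • p j r) α
        (∑ j ∈ Finset.range (m + 1), c j • (1 / (α + (2 * j : ℕ)))) := by
      have hc (j : ℕ) := (hpm j hα).1.const_smul (c j)
      constructor
      · simp only [MellinConvergent, Finset.smul_sum]
        exact integrable_finsetSum _ fun j _ => hc j
      · simp only [mellin, Finset.smul_sum]
        rw [integral_finsetSum _ fun j _ => hc j]
        refine Finset.sum_congr rfl fun j _ => ?_
        rw [← (hpm j hα).2]
        exact mellin_const_smul _ _ _
    have hUm : mellin U α = mellin f α + ∑ j ∈ Finset.range (m + 1), c j • (1 / (α + (2 * j : ℕ))) := by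
      rw [← hsum.2, ← (hasMellin_add hfm hsum.1).2]
      congr 1 with r
      simp [hf]
    have hα2 : 0 < (α / 2).re := by
      rw [show α / 2 = α / (2 : ℝ) by simp, Complex.div_ofReal_re]
      positivity
    simp only [hUm, mul_add, Finset.mul_sum, add_right_inj]
    refine Finset.sum_congr rfl fun j _ => ?_
    rw [gammaInvDiv_of_re_pos hα2, show α + (2 * j : ℕ) = 2 * (α / 2 + j) by push_cast; ring,
      smul_eq_mul, one_div, mul_inv]
    ring
  · simp only [show (-(2 * m : ℂ)) / 2 = -m by ring]
    rw [Complex.Gamma_neg_nat_eq_zero, inv_zero, zero_mul, zero_add, Finset.sum_range_succ,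
      Finset.sum_eq_zero fun j hj => ?_, gammaInvDiv_neg_self]
    · ring
    · rw [gammaInvDiv_neg_of_lt (Finset.mem_range.1 hj), mul_zero]

end MellinContinuation

section RieszKernel

theorem hasMellin_exp_neg_sq_div {ρ : ℝ} (hρ : 0 < ρ) {s : ℂ} (hs : 0 < s.re) :
    HasMellin (fun r : ℝ => ((Real.exp (-(ρ / r) ^ 2) : ℝ) : ℂ)) (-s)
      (Complex.Gamma (s / 2) / 2 * (ρ : ℂ) ^ (-s)) := by
  set g : ℝ → ℂ := fun t => ((Real.exp (-t) : ℝ) : ℂ) with hg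
  have hs2 : 0 < (s / 2).re := by
    rw [show s / 2 = s / (2 : ℝ) by simp, Complex.div_ofReal_re]
    positivity
  have hgc : MellinConvergent g (s / 2) := by
    refine (Complex.GammaIntegral_convergent hs2).congr_fun (fun t _ => ?_) measurableSet_Ioi
    simp [hg, mul_comm]
  have hgm : mellin g (s / 2) = Complex.Gamma (s / 2) := by
    rw [Complex.Gamma_eq_integral hs2, Complex.GammaIntegral_eq_mellin]
  have hρ2 : 0 < ρ ^ 2 := by positivity
  have hs' : -s / ((-2 : ℝ) : ℂ) = s / 2 := by push_cast; ring
  have heq (r : ℝ) (hr : r ∈ Ioi (0 : ℝ)) :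
      g (ρ ^ 2 * r ^ (-2 : ℝ)) = ((Real.exp (-(ρ / r) ^ 2) : ℝ) : ℂ) := by
    have hr0 : (0 : ℝ) < r := hr
    simp only [hg]
    rw [Real.rpow_neg hr0.le, Real.rpow_two, div_pow, div_eq_mul_inv]
  have h1 : MellinConvergent (fun r : ℝ => g (ρ ^ 2 * r ^ (-2 : ℝ))) (-s) := by
    refine (MellinConvergent.comp_rpow (f := fun t => g (ρ ^ 2 * t)) (a := -2) (by norm_num)).2 ?_
    rw [hs']
    exact (MellinConvergent.comp_mul_left hρ2).2 hgc
  have h2 : mellin (fun r : ℝ => g (ρ ^ 2 * r ^ (-2 : ℝ))) (-s) =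
      Complex.Gamma (s / 2) / 2 * (ρ : ℂ) ^ (-s) := by
    rw [mellin_comp_rpow (fun t => g (ρ ^ 2 * t)), hs', mellin_comp_mul_left g _ hρ2, hgm]
    have : ((ρ ^ 2 : ℝ) : ℂ) ^ (-(s / 2)) = (ρ : ℂ) ^ (-s) := by
      rw [pow_two, Complex.ofReal_mul, Complex.mul_cpow_ofReal_nonneg hρ.le hρ.le,
        ← Complex.cpow_add _ _ (Complex.ofReal_ne_zero.2 hρ.ne')]
      congr 1
      ring
    rw [this]
    simp
    ring
  constructor
  · refine h1.congr_fun (fun r hr => ?_) measurableSet_Ioi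
    simp only [heq r hr]
  · rw [← h2]
    refine setIntegral_congr_fun measurableSet_Ioi (fun r hr => ?_)
    simp only [heq r hr]

variable {V : Type*} [NormedAddCommGroup V] [InnerProductSpace ℝ V] [FiniteDimensional ℝ V]
  [MeasurableSpace V] [BorelSpace V]

theorem gaussMean_eq_integral {φ : V → ℂ} {x : V} {r : ℝ} (hr : 0 < r) :
    gaussMean φ x r = ((r ^ Module.finrank ℝ V)⁻¹ : ℝ) *
      ∫ z : V, ((Real.exp (-(‖z‖ / r) ^ 2) : ℝ) : ℂ) * φ (x + z) := by
  have h := Measure.integral_comp_smul_of_nonneg (volume : Measure V)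
    (fun z => ((Real.exp (-(‖z‖ / r) ^ 2) : ℝ) : ℂ) * φ (x + z)) r (hR := hr.le)
  rw [Complex.real_smul] at h
  rw [← h, gaussMean]
  congr 1 with w
  rw [norm_smul, Real.norm_of_nonneg hr.le, mul_div_cancel_left₀ _ hr.ne']

theorem pow_mul_exp_neg_sq_le (N : ℕ) (q : ℝ) :
    q ^ N * Real.exp (-q ^ 2) ≤ 1 + N.factorial := by
  rw [Real.exp_neg, ← div_eq_mul_inv, div_le_iff₀ (Real.exp_pos _)]
  have h1 := Real.pow_div_factorial_le_exp (q ^ 2) (by positivity) N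
  rw [div_le_iff₀ (by positivity)] at h1
  have h2 : q ^ N ≤ 1 + (q ^ 2) ^ N := by
    rw [← pow_mul, mul_comm 2 N, pow_mul]
    nlinarith [sq_nonneg (q ^ N - 1)]
  have h3 : 1 ≤ Real.exp (q ^ 2) := Real.one_le_exp (by positivity)
  nlinarith

variable [Nontrivial V]

theorem ae_norm_pos : ∀ᵐ z : V, 0 < ‖z‖ := by
  filter_upwards [compl_mem_ae_iff.2 (measure_singleton (0 : V))] with z hz
  exact norm_pos_iff.2 hz

theorem integrable_mul_rpow_norm {ψ : V → ℂ} (hψ : Continuous ψ) {C a : ℝ}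
    (hC : ∀ z, ‖ψ z‖ ≤ C * (1 + ‖z‖) ^ (-a)) {s : ℝ} (hs : 0 < s) (hsa : s < a) :
    Integrable fun z => ‖ψ z‖ * ‖z‖ ^ (s - Module.finrank ℝ V) := by
  have hrad : Integrable fun z : V => (1 + ‖z‖) ^ (-a) * ‖z‖ ^ (s - Module.finrank ℝ V) := by
    rw [integrable_fun_norm_addHaar volume
      (f := fun r : ℝ => (1 + r) ^ (-a) * r ^ (s - Module.finrank ℝ V))]
    have hcont : ContinuousOn (fun r : ℝ => (1 + r) ^ (-a)) (Ioi 0) :=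
      ContinuousOn.rpow_const (by fun_prop) fun r (hr : 0 < r) => .inl (by positivity)
    refine (mellin_convergent_of_isBigO_scalar (a := a) (b := 0)
      (hcont.locallyIntegrableOn measurableSet_Ioi) ?_ hsa ?_ hs).congr_fun (fun r hr => ?_)
      measurableSet_Ioi
    · refine IsBigO.of_bound 1 ?_
      filter_upwards [eventually_gt_atTop 0] with r hr
      rw [Real.norm_of_nonneg (by positivity), Real.norm_of_nonneg (by positivity), one_mul]
      exact Real.rpow_le_rpow_of_nonpos hr (by linarith) (by linarith)
    · refine IsBigO.of_bound 1 ?_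
      filter_upwards [self_mem_nhdsWithin] with r (hr : 0 < r)
      rw [Real.norm_of_nonneg (by positivity), neg_zero, Real.rpow_zero, norm_one, one_mul]
      exact Real.rpow_le_one_of_one_le_of_nonpos (by linarith) (by linarith)
    · have hr0 : (0 : ℝ) < r := hr
      have hd : 1 ≤ Module.finrank ℝ V := Module.finrank_pos
      simp only [smul_eq_mul]
      rw [← Real.rpow_natCast r, Nat.cast_sub hd, mul_left_comm, ← Real.rpow_add hr0, mul_comm]
      congr 2
      push_cast
      ring
  refine (hrad.const_mul C).mono'
    (Measurable.aestronglyMeasurable (by have := hψ.measurable; fun_prop)) (.of_forall fun z => ?_)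
  rw [Real.norm_of_nonneg (by positivity), ← mul_assoc]
  gcongr
  exact hC z

theorem differentiableAt_integral_mul_cpow_norm {ψ : V → ℂ} (hψ : Continuous ψ) {C a : ℝ}
    (hC : ∀ z, ‖ψ z‖ ≤ C * (1 + ‖z‖) ^ (-a)) {α : ℂ} (hα : 0 < α.re) (hαa : α.re < a) :
    DifferentiableAt ℂ
      (fun β : ℂ => ∫ z : V, ψ z * (‖z‖ : ℂ) ^ (β - Module.finrank ℝ V)) α := by
  obtain ⟨δ, hδ, hδ1, hδ2⟩ : ∃ δ : ℝ, 0 < δ ∧ 0 < α.re - 2 * δ ∧ α.re + 2 * δ < a := by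
    refine ⟨min (α.re) (a - α.re) / 4, ?_, ?_, ?_⟩ <;>
      rcases min_cases (α.re) (a - α.re) with h | h <;> linarith
  set d : ℝ := ((Module.finrank ℝ V : ℕ) : ℝ) with hd
  have hmeas (β : ℂ) :
      AEStronglyMeasurable (fun z : V => ψ z * (‖z‖ : ℂ) ^ (β - Module.finrank ℝ V)) :=
    Measurable.aestronglyMeasurable (by have := hψ.measurable; fun_prop)
  have hnorm (β : ℂ) {ρ : ℝ} (hρ : 0 < ρ) :
      ‖(ρ : ℂ) ^ (β - Module.finrank ℝ V)‖ = ρ ^ (β.re - d) := by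
    rw [Complex.norm_cpow_eq_rpow_re_of_pos hρ]
    simp [hd]
  refine (hasDerivAt_integral_of_dominated_loc_of_deriv_le (μ := (volume : Measure V))
    (s := ball α δ) (F := fun (β : ℂ) z => ψ z * (‖z‖ : ℂ) ^ (β - Module.finrank ℝ V))
    (F' := fun (β : ℂ) z => ψ z * ((‖z‖ : ℂ) ^ (β - Module.finrank ℝ V) * Complex.log ‖z‖))
    (bound := fun z => 2 / δ * (‖ψ z‖ * ‖z‖ ^ (α.re + 2 * δ - d) +
      ‖ψ z‖ * ‖z‖ ^ (α.re - 2 * δ - d)))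
    (ball_mem_nhds α hδ) (.of_forall hmeas) ?_ ?_ ?_ ?_ ?_).2.differentiableAt
  · refine (integrable_mul_rpow_norm hψ hC hα hαa).mono' (hmeas α) ?_
    filter_upwards [ae_norm_pos] with z hz
    rw [norm_mul, hnorm α hz]
  · exact Measurable.aestronglyMeasurable (by have := hψ.measurable; fun_prop)
  · filter_upwards [ae_norm_pos] with z hz β hβ
    have hre : |β.re - α.re| < δ := by
      have := Complex.abs_re_le_norm (β - α)
      rw [Complex.sub_re] at this
      exact this.trans_lt (mem_ball_iff_norm.1 hβ)
    rw [abs_lt] at hre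
    generalize ‖z‖ = ρ at hz
    rw [norm_mul, norm_mul, hnorm β hz, ← Complex.ofReal_log hz.le, Complex.norm_real,
      Real.norm_eq_abs, ← mul_add, mul_left_comm (2 / δ)]
    refine mul_le_mul_of_nonneg_left ?_ (norm_nonneg (ψ z))
    set P := ρ ^ δ with hP
    set Q := ρ ^ (-δ) with hQ
    have hP0 : 0 < P := Real.rpow_pos_of_pos hz _
    have hQ0 : 0 < Q := Real.rpow_pos_of_pos hz _
    have hPQ : P * Q = 1 := by rw [hP, hQ, ← Real.rpow_add hz]; simp
    have hlog : |Real.log ρ| ≤ (P + Q) / δ := by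
      have h1 := Real.log_le_rpow_div hz.le hδ
      have h2 := Real.log_le_rpow_div (inv_pos.2 hz).le hδ
      rw [Real.log_inv, Real.inv_rpow hz.le, ← Real.rpow_neg hz.le] at h2
      have h3 : 0 ≤ P / δ := by positivity
      have h4 : 0 ≤ Q / δ := by positivity
      rw [add_div]
      exact abs_le.2 ⟨by linarith, by linarith⟩
    have hpow : ρ ^ (β.re - d) ≤ ρ ^ (α.re - d) * (P + Q) := by
      rw [show β.re - d = (α.re - d) + (β.re - α.re) by ring, Real.rpow_add hz]
      gcongr
      rcases le_total 1 ρ with h1 | h1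
      · have := Real.rpow_le_rpow_of_exponent_le h1 hre.2.le
        linarith
      · have := Real.rpow_le_rpow_of_exponent_ge hz h1 hre.1.le
        linarith
    have e1 : ρ ^ (α.re + 2 * δ - d) = ρ ^ (α.re - d) * (P * P) := by
      rw [hP, ← Real.rpow_add hz, ← Real.rpow_add hz]
      congr 1
      ring
    have e2 : ρ ^ (α.re - 2 * δ - d) = ρ ^ (α.re - d) * (Q * Q) := by
      rw [hQ, ← Real.rpow_add hz, ← Real.rpow_add hz]
      congr 1
      ring
    rw [e1, e2]
    calc _ ≤ (ρ ^ (α.re - d) * (P + Q)) * ((P + Q) / δ) := by gcongr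
      _ = ρ ^ (α.re - d) / δ * (P + Q) ^ 2 := by ring
      _ ≤ ρ ^ (α.re - d) / δ * (2 * (P * P + Q * Q)) := by
        gcongr
        nlinarith [sq_nonneg (P - Q)]
      _ = _ := by ring
  · exact ((integrable_mul_rpow_norm hψ hC (by linarith) hδ2).add
      (integrable_mul_rpow_norm hψ hC hδ1 (by linarith))).const_mul _
  · filter_upwards [ae_norm_pos] with z hz β _
    have := ((hasDerivAt_id β).sub_const (Module.finrank ℝ V : ℂ)).const_cpow
      (c := (‖z‖ : ℂ)) (.inl (Complex.ofReal_ne_zero.2 hz.ne'))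
    simpa using this.const_mul (ψ z)

theorem isBigO_gaussMean {φ : V → ℂ} {x : V} (hφ : Continuous φ) {C a : ℝ} (ha : 1 < a)
    (hC : ∀ z, ‖φ (x + z)‖ ≤ C * (1 + ‖z‖) ^ (-a)) :
    gaussMean φ x =O[atTop] fun r => r ^ (-1 : ℝ) := by
  have hd : 1 ≤ Module.finrank ℝ V := Module.finrank_pos
  set N := Module.finrank ℝ V - 1 with hN
  have hi := (integrable_mul_rpow_norm (ψ := fun z => φ (x + z)) (by fun_prop) hC one_pos ha)
  refine IsBigO.of_bound ((1 + N.factorial) *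
    ∫ z, ‖φ (x + z)‖ * ‖z‖ ^ ((1 : ℝ) - Module.finrank ℝ V)) ?_
  filter_upwards [eventually_gt_atTop 0] with r hr
  have key : ‖∫ z : V, ((Real.exp (-(‖z‖ / r) ^ 2) : ℝ) : ℂ) * φ (x + z)‖ ≤
      ∫ z, (r ^ N * (1 + N.factorial)) *
        (‖φ (x + z)‖ * ‖z‖ ^ ((1 : ℝ) - Module.finrank ℝ V)) := by
    refine norm_integral_le_of_norm_le (hi.const_mul _) ?_
    filter_upwards [ae_norm_pos] with z hz
    rw [norm_mul, Complex.norm_real, Real.norm_of_nonneg (Real.exp_pos _).le, mul_left_comm,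
      mul_comm]
    gcongr
    have h1 := pow_mul_exp_neg_sq_le N (‖z‖ / r)
    have h2 : ‖z‖ ^ ((1 : ℝ) - Module.finrank ℝ V) = (‖z‖ ^ N)⁻¹ := by
      rw [← Real.rpow_natCast, ← Real.rpow_neg hz.le, hN, Nat.cast_sub hd]
      congr 1
      push_cast
      ring
    rw [h2, ← div_eq_mul_inv, le_div_iff₀ (by positivity)]
    rw [div_pow, div_mul_eq_mul_div, div_le_iff₀ (by positivity)] at h1
    linarith
  rw [gaussMean_eq_integral hr, norm_mul, Complex.norm_real,
    Real.norm_of_nonneg (by positivity), Real.norm_of_nonneg (by positivity)]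
  rw [integral_const_mul] at key
  refine (mul_le_mul_of_nonneg_left key (by positivity)).trans_eq ?_
  rw [← mul_assoc, mul_comm]
  conv_rhs => rw [mul_right_comm, mul_comm]
  congr 1
  rw [show Module.finrank ℝ V = N + 1 by omega, Real.rpow_neg_one, pow_succ]
  field_simp

theorem mellin_gaussMean {φ : V → ℂ} {x : V} (hφ : Continuous φ) {C a : ℝ}
    (hC : ∀ z, ‖φ (x + z)‖ ≤ C * (1 + ‖z‖) ^ (-a)) {α : ℂ} (hα : 0 < α.re) (hαa : α.re < a)
    (hαd : α.re < Module.finrank ℝ V) :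
    mellin (gaussMean φ x) α = Complex.Gamma ((Module.finrank ℝ V - α) / 2) / 2 *
      ∫ z : V, φ (x + z) * (‖z‖ : ℂ) ^ (α - Module.finrank ℝ V) := by
  set d := Module.finrank ℝ V with hd
  set K : ℝ → V → ℂ := fun r z =>
    (r : ℂ) ^ (-(d - α) - 1) • ((Real.exp (-(‖z‖ / r) ^ 2) : ℝ) : ℂ) * φ (x + z) with hK
  have hs : 0 < ((d : ℂ) - α).re := by simpa using hαd
  have hinner {z : V} (hz : 0 < ‖z‖) := hasMellin_exp_neg_sq_div hz hs
  have hKint {z : V} (hz : 0 < ‖z‖) : IntegrableOn (fun r => K r z) (Ioi 0) :=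
    (hinner hz).1.mul_const (φ (x + z))
  have hKval {z : V} (hz : 0 < ‖z‖) : ∫ r in Ioi 0, K r z =
      Complex.Gamma ((d - α) / 2) / 2 * (φ (x + z) * (‖z‖ : ℂ) ^ (α - d)) := by
    have h2 := (hinner hz).2
    rw [mellin] at h2
    rw [hK]
    simp only [integral_mul_const]
    rw [h2, neg_sub]
    ring
  have hKnorm {z : V} (hz : 0 < ‖z‖) : ∫ r in Ioi 0, ‖K r z‖ =
      ‖Complex.Gamma (((d - α.re : ℝ) : ℂ) / 2) / 2‖ *
        (‖φ (x + z)‖ * ‖z‖ ^ (α.re - d)) := by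
    have hs' : 0 < (((d - α.re : ℝ) : ℂ)).re := by simpa using hαd
    have h2 := (hasMellin_exp_neg_sq_div hz hs').2
    rw [mellin] at h2
    have h3 : ∫ r in Ioi (0 : ℝ), r ^ (-(d - α.re) - 1) * Real.exp (-(‖z‖ / r) ^ 2) =
        ‖Complex.Gamma (((d - α.re : ℝ) : ℂ) / 2) / 2‖ * ‖z‖ ^ (α.re - d) := by
      have h4 : ∫ r in Ioi (0 : ℝ), (r : ℂ) ^ (-((d - α.re : ℝ) : ℂ) - 1) •
            ((Real.exp (-(‖z‖ / r) ^ 2) : ℝ) : ℂ) =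
          ((∫ r in Ioi (0 : ℝ), r ^ (-(d - α.re) - 1) * Real.exp (-(‖z‖ / r) ^ 2) : ℝ) : ℂ) := by
        rw [← integral_complex_ofReal]
        refine setIntegral_congr_fun measurableSet_Ioi fun r hr => ?_
        have hr0 : (0 : ℝ) < r := hr
        simp only [smul_eq_mul, Complex.ofReal_mul, Complex.ofReal_cpow hr0.le]
        push_cast
        rfl
      rw [h4] at h2
      have h5 := congrArg norm h2
      rw [Complex.norm_real, Real.norm_of_nonneg (setIntegral_nonneg measurableSet_Ioi
        fun r hr => mul_nonneg (Real.rpow_nonneg (le_of_lt hr) _) (Real.exp_pos _).le), norm_mul,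
        Complex.norm_cpow_eq_rpow_re_of_pos hz] at h5
      rw [h5]
      simp
    rw [mul_left_comm, ← mul_assoc, mul_comm ‖φ (x + z)‖, mul_assoc, mul_comm ‖φ (x + z)‖,
      ← mul_assoc, ← h3, ← integral_mul_const]
    refine setIntegral_congr_fun measurableSet_Ioi fun r hr => ?_
    have hr0 : (0 : ℝ) < r := hr
    simp only [hK, smul_eq_mul, norm_mul, Complex.norm_real,
      Real.norm_of_nonneg (Real.exp_pos _).le, Complex.norm_cpow_eq_rpow_re_of_pos hr0]
    simp
  have hmeas : AEStronglyMeasurable (Function.uncurry K)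
      ((volume.restrict (Ioi 0)).prod (volume : Measure V)) := by
    have := hφ.measurable
    refine Measurable.aestronglyMeasurable ?_
    simp only [hK, Function.uncurry_def, smul_eq_mul]
    fun_prop
  have hprod : Integrable (Function.uncurry K)
      ((volume.restrict (Ioi 0)).prod (volume : Measure V)) := by
    refine (integrable_prod_iff' hmeas).2 ⟨?_, ?_⟩
    · filter_upwards [ae_norm_pos] with z hz using hKint hz
    · refine (((integrable_mul_rpow_norm (ψ := fun z => φ (x + z)) (by fun_prop) hC hα
        hαa).const_mul ‖Complex.Gamma (((d - α.re : ℝ) : ℂ) / 2) / 2‖).congr ?_)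
      filter_upwards [ae_norm_pos] with z hz using (hKnorm hz).symm
  calc mellin (gaussMean φ x) α = ∫ r in Ioi (0 : ℝ), ∫ z : V, K r z := by
        refine setIntegral_congr_fun measurableSet_Ioi fun r hr => ?_
        have hr0 : (0 : ℝ) < r := hr
        simp only [hK, gaussMean_eq_integral hr0, smul_eq_mul, mul_assoc]
        rw [integral_const_mul, ← mul_assoc]
        congr 1
        rw [show -((d : ℂ) - α) - 1 = (α - 1) - d by ring,
          Complex.cpow_sub (α - 1) (d : ℂ) (Complex.ofReal_ne_zero.2 hr0.ne'), Complex.cpow_natCast]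
        push_cast
        rfl
    _ = ∫ z : V, ∫ r in Ioi (0 : ℝ), K r z := integral_integral_swap hprod
    _ = ∫ z : V, Complex.Gamma ((d - α) / 2) / 2 * (φ (x + z) * (‖z‖ : ℂ) ^ (α - d)) :=
        integral_congr_ae (by filter_upwards [ae_norm_pos] with z hz using hKval hz)
    _ = _ := integral_const_mul _ _

end RieszKernel

section Decay

variable {V E : Type*} [NormedAddCommGroup V] [NormedAddCommGroup E]

theorem exists_norm_sub_le_mul_rpow_of_isOpen {f : V → E} (hf : ∃ C, ∀ y, ‖f y‖ ≤ C) {x : V}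
    {U : Set V} (hU : IsOpen U) (hx : x ∈ U) {θ M : ℝ} (hθ : 0 < θ)
    (hM : ∀ y ∈ U, ‖f y - f x‖ ≤ M * ‖y - x‖ ^ θ) :
    ∃ C, ∀ y, ‖f y - f x‖ ≤ C * ‖y - x‖ ^ θ := by
  obtain ⟨B, hB⟩ := hf
  obtain ⟨δ, hδ, hδU⟩ := Metric.isOpen_iff.1 hU x hx
  have hB0 : 0 ≤ B := (norm_nonneg _).trans (hB x)
  refine ⟨|M| + 2 * B / δ ^ θ, fun y => ?_⟩
  rw [add_mul]
  by_cases hy : y ∈ ball x δ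
  · refine (hM y (hδU hy)).trans ?_
    have h1 : M * ‖y - x‖ ^ θ ≤ |M| * ‖y - x‖ ^ θ := by gcongr; exact le_abs_self M
    exact h1.trans (le_add_of_nonneg_right (by positivity))
  · rw [mem_ball_iff_norm, not_lt] at hy
    have h1 : 2 * B ≤ 2 * B / δ ^ θ * ‖y - x‖ ^ θ := by
      rw [div_mul_eq_mul_div, le_div_iff₀ (by positivity)]
      gcongr
    have h2 := norm_sub_le_of_le (hB y) (hB x)
    have h3 : 0 ≤ |M| * ‖y - x‖ ^ θ := by positivity
    linarith

variable [ProperSpace V]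

theorem exists_norm_add_le_of_isBigO_cocompact {f : V → E} (hf : Continuous f) {a : ℝ}
    (ha : 0 ≤ a) (hfO : f =O[cocompact V] fun y => ‖y‖ ^ (-a)) (x : V) :
    ∃ C, ∀ z, ‖f (x + z)‖ ≤ C * (1 + ‖z‖) ^ (-a) := by
  obtain ⟨C, hC0, hC⟩ := hfO.exists_nonneg
  obtain ⟨R, hR⟩ : ∃ R, ∀ y, R < ‖y‖ → ‖f y‖ ≤ C * ‖y‖ ^ (-a) := by
    have h := hC.bound
    rw [← cobounded_eq_cocompact, ← comap_norm_atTop, eventually_comap] at h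
    obtain ⟨R, hR⟩ := eventually_atTop.1 h
    refine ⟨R, fun y hy => ?_⟩
    simpa [abs_of_nonneg (Real.rpow_nonneg (norm_nonneg y) _)] using hR ‖y‖ hy.le y rfl
  obtain ⟨M, hM⟩ := (isCompact_closedBall (0 : V) (max R 1)).exists_bound_of_continuousOn
    hf.continuousOn
  have hM0 : 0 ≤ M := (norm_nonneg _).trans (hM 0 (by simp))
  have hscale {b c : ℝ} (hb : 0 < b) (hc : 0 < c) {z : V} (h : 1 + ‖z‖ ≤ b * c) :
      c ^ (-a) ≤ b ^ a * (1 + ‖z‖) ^ (-a) := by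
    rw [Real.rpow_neg hc.le, Real.rpow_neg (by positivity), ← div_eq_mul_inv,
      le_div_iff₀ (by positivity), inv_mul_le_iff₀ (by positivity), mul_comm,
      ← Real.mul_rpow hb.le hc.le]
    exact Real.rpow_le_rpow (by positivity) h ha
  refine ⟨M * (1 + max R 1 + ‖x‖) ^ a + C * (2 + ‖x‖) ^ a, fun z => ?_⟩
  have hz : ‖z‖ ≤ ‖x + z‖ + ‖x‖ := by simpa using norm_sub_le (x + z) x
  have hx := norm_nonneg x
  rw [add_mul, mul_assoc, mul_assoc]
  rcases le_or_gt ‖x + z‖ (max R 1) with h | h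
  · have h1 := hscale (b := 1 + max R 1 + ‖x‖) (z := z) (by positivity) one_pos (by linarith)
    rw [Real.one_rpow] at h1
    have h2 := hM (x + z) (by simpa using h)
    calc ‖f (x + z)‖ ≤ M * 1 := by simpa using h2
      _ ≤ M * ((1 + max R 1 + ‖x‖) ^ a * (1 + ‖z‖) ^ (-a)) := by gcongr
      _ ≤ _ := le_add_of_nonneg_right (by positivity)
  · have h1 : 1 < ‖x + z‖ := (le_max_right _ _).trans_lt h
    have h2 := hscale (b := 2 + ‖x‖) (c := ‖x + z‖) (z := z) (by positivity) (by positivity)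
      (by nlinarith)
    calc ‖f (x + z)‖ ≤ C * ‖x + z‖ ^ (-a) := hR _ ((le_max_left _ _).trans_lt h)
      _ ≤ C * ((2 + ‖x‖) ^ a * (1 + ‖z‖) ^ (-a)) := by gcongr
      _ ≤ _ := le_add_of_nonneg_left (by positivity)

theorem exists_norm_le_of_isBigO_cocompact {f : V → E} (hf : Continuous f) {a : ℝ}
    (ha : 0 ≤ a) (hfO : f =O[cocompact V] fun y => ‖y‖ ^ (-a)) : ∃ C, ∀ y, ‖f y‖ ≤ C := by
  obtain ⟨C, hC⟩ := exists_norm_add_le_of_isBigO_cocompact hf ha hfO 0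
  have hC0 : 0 ≤ C := (norm_nonneg _).trans (by simpa using hC 0)
  refine ⟨C, fun y => ?_⟩
  have h1 : (1 + ‖y‖) ^ (-a) ≤ 1 :=
    Real.rpow_le_one_of_one_le_of_nonpos (by linarith [norm_nonneg y]) (by linarith)
  simpa using (hC y).trans (mul_le_of_le_one_right hC0 h1)

end Decay

section Riesz

variable {n : ℕ}

theorem inv_Hfun (n : ℕ) (α : ℂ) :
    (Hfun n α)⁻¹ = ((2 : ℂ) ^ α * (Real.pi : ℂ) ^ ((n : ℂ) / 2))⁻¹ * (Complex.Gamma (α / 2))⁻¹ *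
      Complex.Gamma ((n - α) / 2) := by
  rw [Hfun, inv_div, div_eq_mul_inv, mul_inv, mul_comm]

theorem riesz_eq_integral_add (f : EuclideanSpace ℝ (Fin n) → ℂ) (α : ℂ)
    (x : EuclideanSpace ℝ (Fin n)) :
    riesz n f α x = (Hfun n α)⁻¹ * ∫ z, f (x + z) *
      (‖z‖ : ℂ) ^ (α - Module.finrank ℝ (EuclideanSpace ℝ (Fin n))) := by
  rw [riesz, finrank_euclideanSpace_fin,
    ← integral_add_left_eq_self (fun y => f y * (‖x - y‖ : ℂ) ^ (α - n)) x]
  simp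

theorem differentiable_two_cpow_mul_pi_cpow_inv (n : ℕ) :
    Differentiable ℂ fun α : ℂ => ((2 : ℂ) ^ α * (Real.pi : ℂ) ^ ((n : ℂ) / 2))⁻¹ := by
  intro α
  refine DifferentiableAt.inv ?_ ?_
  · exact (differentiableAt_id.const_cpow (.inl two_ne_zero)).mul_const _
  · simp [Complex.cpow_eq_zero_iff, Real.pi_ne_zero]

theorem differentiableAt_riesz [NeZero n] {f : EuclideanSpace ℝ (Fin n) → ℂ} (hf : Continuous f)
    {x : EuclideanSpace ℝ (Fin n)} {C a : ℝ}
    (hC : ∀ z, ‖f (x + z)‖ ≤ C * (1 + ‖z‖) ^ (-a)) {α : ℂ} (hα : 0 < α.re) (hαa : α.re < a)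
    (hαn : α ∉ poleSet n) : DifferentiableAt ℂ (fun β => riesz n f β x) α := by
  simp only [riesz_eq_integral_add, inv_Hfun]
  refine (((differentiable_two_cpow_mul_pi_cpow_inv n α).mul ?_).mul ?_).mul
    (differentiableAt_integral_mul_cpow_norm (ψ := fun z => f (x + z)) (by fun_prop) hC hα hαa)
  · exact (Complex.differentiable_one_div_Gamma.comp (f := fun β : ℂ => β / 2)
      (by fun_prop)).differentiableAt
  · refine (Complex.differentiableAt_Gamma _ fun j hj => hαn ⟨j, ?_⟩).comp α (by fun_prop)
    linear_combination -2 * hj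

theorem exists_continuation_riesz [NeZero n] {f : EuclideanSpace ℝ (Fin n) → ℂ}
    {x : EuclideanSpace ℝ (Fin n)} {m : ℕ} {θ : ℝ} (hθ : 0 < θ)
    (hf : HolderRegularAt (2 * m) θ f x) {C a : ℝ} (ha : 1 < a)
    (hC : ∀ z, ‖f (x + z)‖ ≤ C * (1 + ‖z‖) ^ (-a)) :
    ∃ F : ℂ → ℂ, DifferentiableOn ℂ F {α | -(2 * m : ℝ) - θ < α.re ∧ α.re < 1} ∧
      (∀ α : ℂ, 0 < α.re → α.re < 1 → F α = riesz n f α x) ∧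
      F (-(2 * m)) = ((fun (g : EuclideanSpace ℝ (Fin n) → ℂ) => fun y => -(lap n g y))^[m] f) x := by
  obtain ⟨B, hB⟩ := hf.exists_norm_gaussMean_sub_sum_le hθ
  obtain ⟨G, hG, hGeq, hGval⟩ := exists_continuation_mellin_div_Gamma
    (continuous_gaussMean hf.continuous hf.exists_norm_le x)
    (isBigO_gaussMean hf.continuous ha hC) m hθ _ hB
  refine ⟨fun α => 2 * ((2 : ℂ) ^ α * (Real.pi : ℂ) ^ ((n : ℂ) / 2))⁻¹ * G α,
    (((differentiable_two_cpow_mul_pi_cpow_inv n).const_mul 2).differentiableOn.mul hG),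
    fun α hα0 hα1 => ?_, ?_⟩
  · have hn : (1 : ℝ) ≤ n := by exact_mod_cast NeZero.one_le
    have hαn : α.re < Module.finrank ℝ (EuclideanSpace ℝ (Fin n)) := by
      rw [finrank_euclideanSpace_fin]
      linarith
    beta_reduce
    rw [hGeq α hα0 hα1, mellin_gaussMean hf.continuous hC hα0 (by linarith) hαn,
      riesz_eq_integral_add, inv_Hfun, finrank_euclideanSpace_fin]
    ring
  · have h2 : (2 : ℂ) ^ (-(2 * m : ℂ)) = ((4 : ℂ) ^ m)⁻¹ := by
      rw [Complex.cpow_neg, show (2 * m : ℂ) = ((2 * m : ℕ) : ℂ) by push_cast; rfl,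
        Complex.cpow_natCast, pow_mul]
      norm_num
    have hpi : (Real.pi : ℂ) ^ ((n : ℂ) / 2) ≠ 0 := by
      simp [Complex.cpow_eq_zero_iff, Real.pi_ne_zero]
    have hfac : (m.factorial : ℂ) ≠ 0 := by exact_mod_cast m.factorial_ne_zero
    have hsq : ((-1 : ℂ) ^ m) ^ 2 = 1 := by rw [← pow_mul, mul_comm, pow_mul]; simp
    simp only [hGval, gaussMean_zero, finrank_euclideanSpace_fin, h2]
    field_simp
    rw [hsq, one_mul]

end Riesz

theorem stmt_19 (n : ℕ) (hn : 0 < n) (k m : ℕ) (hm : 0 < m) (hkm : k = 2 * m)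
    (ε : ℝ) (hε : 0 < ε)
    (h : EuclideanSpace ℝ (Fin n) → ℂ) (hh : ContDiff ℝ k h)
    (hHolder : ∀ z : EuclideanSpace ℝ (Fin n),
      ∃ (U : Set (EuclideanSpace ℝ (Fin n))) (θ : ℝ) (M : ℝ), IsOpen U ∧ z ∈ U ∧
        0 < θ ∧ θ < 1 ∧
        ∀ x₁ ∈ U, ∀ x₂ ∈ U,
          ‖iteratedFDeriv ℝ k h x₁ - iteratedFDeriv ℝ k h x₂‖ ≤ M * ‖x₁ - x₂‖ ^ θ)
    (hdecay : ∀ j : ℕ, j ≤ k →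
      (fun x => iteratedFDeriv ℝ j h x)
        =O[cocompact (EuclideanSpace ℝ (Fin n))] fun x => ‖x‖ ^ (-(2 : ℝ) - ε)) :
    ∀ x : EuclideanSpace ℝ (Fin n),
      ∃ η : ℝ, 0 < η ∧
        ∃ F : ℂ → ℂ,
          DifferentiableOn ℂ F ({α : ℂ | -(k : ℝ) - η < α.re ∧ α.re < 2 + ε} \ poleSet n) ∧
          (∀ α : ℂ, 0 < α.re → α.re < 2 + ε → α ∉ poleSet n → F α = riesz n h α x) ∧
          F (-(k : ℂ)) =
            ((fun (g : EuclideanSpace ℝ (Fin n) → ℂ) => fun y => -(lap n g y))^[m] h) x := by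
  intro x
  subst hkm
  have : NeZero n := ⟨hn.ne'⟩
  obtain ⟨U, θ, M, hU, hxU, hθ, -, hM⟩ := hHolder x
  have hdecay' (j : ℕ) (hj : j ≤ 2 * m) : (iteratedFDeriv ℝ j h)
      =O[cocompact (EuclideanSpace ℝ (Fin n))] fun y => ‖y‖ ^ (-(2 + ε)) := by
    simpa only [neg_add'] using hdecay j hj
  have hcont (j : ℕ) (hj : j ≤ 2 * m) : Continuous (iteratedFDeriv ℝ j h) :=
    hh.continuous_iteratedFDeriv (by exact_mod_cast hj)
  have hbdd (j : ℕ) (hj : j ≤ 2 * m) : ∃ C, ∀ y, ‖iteratedFDeriv ℝ j h y‖ ≤ C :=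
    exists_norm_le_of_isBigO_cocompact (hcont j hj) (by positivity) (hdecay' j hj)
  have hreg : HolderRegularAt (2 * m) θ h x := ⟨hh, hbdd,
    exists_norm_sub_le_mul_rpow_of_isOpen (hbdd _ le_rfl) hU hxU hθ fun y hy => hM y hy x hxU⟩
  obtain ⟨C, hC⟩ := exists_norm_add_le_of_isBigO_cocompact (hcont 0 (Nat.zero_le _))
    (by positivity) (hdecay' 0 (Nat.zero_le _)) x
  simp only [norm_iteratedFDeriv_zero] at hC
  obtain ⟨G, hG, hGeq, hGval⟩ := exists_continuation_riesz hθ hreg (by linarith) hC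
  set F : ℂ → ℂ := fun α => if α.re < 1 then G α else riesz n h α x with hF
  have hFr {α : ℂ} (hα : 0 < α.re) : F α = riesz n h α x := by
    by_cases h1 : α.re < 1
    · simp only [hF, if_pos h1, hGeq α hα h1]
    · simp only [hF, if_neg h1]
  refine ⟨θ, hθ, F, fun α hα => ?_, fun α hα _ _ => hFr hα, ?_⟩
  · obtain ⟨⟨hα1, hα2⟩, hαn⟩ := hα
    refine DifferentiableAt.differentiableWithinAt ?_
    rcases lt_or_ge 0 α.re with h0 | h0
    · refine (differentiableAt_riesz hreg.continuous hC h0 hα2 hαn).congr_of_eventuallyEq ?_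
      filter_upwards [(isOpen_lt continuous_const Complex.continuous_re).mem_nhds h0] with β hβ
      exact hFr hβ
    · have h1 : α.re < 1 := by linarith
      have hopen : IsOpen {β : ℂ | -(2 * m : ℝ) - θ < β.re ∧ β.re < 1} :=
        (isOpen_lt continuous_const Complex.continuous_re).inter
          (isOpen_lt Complex.continuous_re continuous_const)
      push_cast at hα1
      refine (hG.differentiableAt (hopen.mem_nhds ⟨hα1, h1⟩)).congr_of_eventuallyEq ?_
      filter_upwards [(isOpen_lt Complex.continuous_re continuous_const).mem_nhds h1] with β hβ
      simp only [hF, if_pos hβ]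
  · have h1 : (-((2 * m : ℕ) : ℂ)).re < 1 := by
      rw [Complex.neg_re, Complex.natCast_re]
      linarith [Nat.cast_nonneg (α := ℝ) (2 * m)]
    simp only [hF, if_pos h1]
    rw [← hGval]
    push_cast
    rfl
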